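/- arXiv:2310.07636 — 2 statements merged into one kernel-verified Lean document; each statement's English description precedes it below -/
import Mathlib

section
/- Let θ be an irrational real number and let m ≥ 2 be an integer. Then 1 is an element of the positive partition p⁺_θ(m) if and only if 1 is not an element of the negative partition p⁻_θ(m). -/
open Set

/-- The inclusion of an integer lattice point into the real plane. -/
def latticeToR (p : ℤ × ℤ) : ℝ × ℝ := ((p.1 : ℝ), (p.2 : ℝ))

/-- A polygonal path with vertices at integer lattice points, starting at `(0,0)`,
ending at `(m, e)`, with strictly increasing x-coordinates of the vertices, so that
the path is the graph of a piecewise linear function on `[0, m]`. -/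
structure LatticePath (m : ℕ) (e : ℤ) where
  n : ℕ
  v : Fin (n + 1) → ℤ × ℤ
  first : v 0 = (0, 0)
  last : v (Fin.last n) = ((m : ℤ), e)
  mono : ∀ i : Fin n, (v i.castSucc).1 < (v i.succ).1

namespace LatticePath

variable {m : ℕ} {e : ℤ}

/-- The trace of the path in the plane: the union of the closed segments joining
consecutive vertices. -/
def graph (P : LatticePath m e) : Set (ℝ × ℝ) :=
  ⋃ i : Fin P.n, segment ℝ (latticeToR (P.v i.castSucc)) (latticeToR (P.v i.succ))

/-- The slopes of consecutive edges are nonincreasing: the path is the graph of a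
piecewise linear concave function. -/
def IsConcave (P : LatticePath m e) : Prop :=
  ∀ i : ℕ, ∀ h : i + 2 ≤ P.n,
    ((P.v ⟨i + 2, by omega⟩).2 - (P.v ⟨i + 1, by omega⟩).2) *
        ((P.v ⟨i + 1, by omega⟩).1 - (P.v ⟨i, by omega⟩).1) ≤
      ((P.v ⟨i + 1, by omega⟩).2 - (P.v ⟨i, by omega⟩).2) *
        ((P.v ⟨i + 2, by omega⟩).1 - (P.v ⟨i + 1, by omega⟩).1)

/-- The slopes of consecutive edges are nondecreasing: the path is the graph of a
piecewise linear convex function. -/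
def IsConvex (P : LatticePath m e) : Prop :=
  ∀ i : ℕ, ∀ h : i + 2 ≤ P.n,
    ((P.v ⟨i + 1, by omega⟩).2 - (P.v ⟨i, by omega⟩).2) *
        ((P.v ⟨i + 2, by omega⟩).1 - (P.v ⟨i + 1, by omega⟩).1) ≤
      ((P.v ⟨i + 2, by omega⟩).2 - (P.v ⟨i + 1, by omega⟩).2) *
        ((P.v ⟨i + 1, by omega⟩).1 - (P.v ⟨i, by omega⟩).1)

end LatticePath

/-- `S` lies pointwise (in the vertical direction) below `T`. -/
def GraphLE (S T : Set (ℝ × ℝ)) : Prop :=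
  ∀ x y y' : ℝ, (x, y) ∈ S → (x, y') ∈ T → y ≤ y'

/-- An admissible path for the positive partition `p⁺_θ(m)`: a lattice path from
`(0,0)` to `(m, ⌊mθ⌋)` which is the graph of a piecewise linear concave function
and does not go above the line `y = θx`. -/
def PosPath (θ : ℝ) (m : ℕ) (P : LatticePath m ⌊(m : ℝ) * θ⌋) : Prop :=
  P.IsConcave ∧ ∀ p ∈ P.graph, p.2 ≤ θ * p.1

/-- An admissible path for the negative partition `p⁻_θ(m)`: a lattice path from
`(0,0)` to `(m, ⌈mθ⌉)` which is the graph of a piecewise linear convex function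
and does not go below the line `y = θx`. -/
def NegPath (θ : ℝ) (m : ℕ) (P : LatticePath m ⌈(m : ℝ) * θ⌉) : Prop :=
  P.IsConvex ∧ ∀ p ∈ P.graph, θ * p.1 ≤ p.2

/-- `P` is the pointwise maximal admissible path `Λ⁺_θ(m)`. -/
def IsMaxPosPath (θ : ℝ) (m : ℕ) (P : LatticePath m ⌊(m : ℝ) * θ⌋) : Prop :=
  PosPath θ m P ∧
    ∀ Q : LatticePath m ⌊(m : ℝ) * θ⌋, PosPath θ m Q → GraphLE Q.graph P.graph

/-- `P` is the pointwise minimal admissible path `Λ⁻_θ(m)`. -/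
def IsMinNegPath (θ : ℝ) (m : ℕ) (P : LatticePath m ⌈(m : ℝ) * θ⌉) : Prop :=
  NegPath θ m P ∧
    ∀ Q : LatticePath m ⌈(m : ℝ) * θ⌉, NegPath θ m Q → GraphLE P.graph Q.graph

/-- The x-coordinates of the integer lattice points lying on `S`. -/
def latticeXs (S : Set (ℝ × ℝ)) : Set ℤ :=
  {x : ℤ | ∃ y : ℤ, ((x : ℝ), (y : ℝ)) ∈ S}

open Classical in
/-- The multiset of consecutive gaps of a finite set of integers. -/
noncomputable def setGaps (X : Set ℤ) : Multiset ℤ :=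
  if h : X.Finite then
    Multiset.ofList
      (List.zipWith (fun a b => b - a) (h.toFinset.sort (· ≤ ·))
        (h.toFinset.sort (· ≤ ·)).tail)
  else 0

/-- The multiset of horizontal displacements between consecutive integer lattice
points lying on the path `P`: the partition `p⁺_θ(m)` (resp. `p⁻_θ(m)`) is
`pathPartition` of the maximal (resp. minimal) admissible path. -/
noncomputable def pathPartition {m : ℕ} {e : ℤ} (P : LatticePath m e) : Multiset ℤ :=
  setGaps (latticeXs P.graph)

namespace LatticePath

variable {m : ℕ} {e : ℤ}

/-- The x-coordinate of the `i`-th vertex (indices are read modulo `n + 1`). -/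
def xCoord (P : LatticePath m e) (i : ℕ) : ℤ := (P.v (Fin.ofNat (P.n + 1) i)).1

/-- The y-coordinate of the `i`-th vertex (indices are read modulo `n + 1`). -/
def yCoord (P : LatticePath m e) (i : ℕ) : ℤ := (P.v (Fin.ofNat (P.n + 1) i)).2

theorem v_eq (P : LatticePath m e) {i : ℕ} (h : i < P.n + 1) :
    P.v ⟨i, h⟩ = (P.xCoord i, P.yCoord i) := by
  have : Fin.ofNat (P.n + 1) i = ⟨i, h⟩ := Fin.ext (Nat.mod_eq_of_lt h)
  rw [xCoord, yCoord, this]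

theorem coords_zero (P : LatticePath m e) : P.xCoord 0 = 0 ∧ P.yCoord 0 = 0 := by
  have h := P.first
  rw [show (0 : Fin (P.n + 1)) = ⟨0, by omega⟩ from rfl, v_eq] at h
  simpa using h

theorem coords_last (P : LatticePath m e) : P.xCoord P.n = m ∧ P.yCoord P.n = e := by
  have h := P.last
  rw [show Fin.last P.n = ⟨P.n, by omega⟩ from rfl, v_eq] at h
  simpa using h

theorem xCoord_lt_succ (P : LatticePath m e) {i : ℕ} (hi : i < P.n) :
    P.xCoord i < P.xCoord (i + 1) := by
  have h := P.mono ⟨i, hi⟩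
  rwa [show (⟨i, hi⟩ : Fin P.n).castSucc = ⟨i, by omega⟩ from rfl,
    show (⟨i, hi⟩ : Fin P.n).succ = ⟨i + 1, by omega⟩ from rfl, v_eq, v_eq] at h

theorem xCoord_le (P : LatticePath m e) {i j : ℕ} (hij : i ≤ j) (hj : j ≤ P.n) :
    P.xCoord i ≤ P.xCoord j := by
  induction j, hij using Nat.le_induction with
  | base => exact le_rfl
  | succ j _ ih => exact (ih (by omega)).trans (P.xCoord_lt_succ (by omega)).le

theorem isConcave_iff (P : LatticePath m e) :
    P.IsConcave ↔ ∀ i, i + 2 ≤ P.n →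
      (P.yCoord (i + 2) - P.yCoord (i + 1)) * (P.xCoord (i + 1) - P.xCoord i) ≤
        (P.yCoord (i + 1) - P.yCoord i) * (P.xCoord (i + 2) - P.xCoord (i + 1)) := by
  simp only [IsConcave, v_eq]

theorem mem_segment_latticeToR_iff {p q : ℤ × ℤ} (h : p.1 < q.1) (x y : ℝ) :
    (x, y) ∈ segment ℝ (latticeToR p) (latticeToR q) ↔
      (p.1 : ℝ) ≤ x ∧ x ≤ q.1 ∧ (y - p.2) * (q.1 - p.1) = (x - p.1) * (q.2 - p.2) := by
  have hpos : (0 : ℝ) < q.1 - p.1 := sub_pos.2 (by exact_mod_cast h)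
  simp only [segment_eq_image', latticeToR, mem_image, mem_Icc, Prod.mk_sub_mk, Prod.smul_mk,
    Prod.mk_add_mk, Prod.mk.injEq, smul_eq_mul]
  constructor
  · rintro ⟨t, ⟨h0, h1⟩, rfl, rfl⟩
    refine ⟨by nlinarith, by nlinarith, by ring⟩
  · rintro ⟨h0, h1, h2⟩
    refine ⟨(x - p.1) / (q.1 - p.1), ⟨by apply div_nonneg <;> linarith, ?_⟩, ?_, ?_⟩
    · rw [div_le_one hpos]; linarith
    · field_simp; ring
    · field_simp; linarith

theorem mem_graph_iff (P : LatticePath m e) (x y : ℝ) :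
    (x, y) ∈ P.graph ↔ ∃ i < P.n, (P.xCoord i : ℝ) ≤ x ∧ x ≤ P.xCoord (i + 1) ∧
      (y - P.yCoord i) * (P.xCoord (i + 1) - P.xCoord i) =
        (x - P.xCoord i) * (P.yCoord (i + 1) - P.yCoord i) := by
  simp only [graph, mem_iUnion, mem_segment_latticeToR_iff (P.mono _)]
  constructor
  · rintro ⟨⟨i, hi⟩, h⟩
    refine ⟨i, hi, ?_⟩
    rwa [show (⟨i, hi⟩ : Fin P.n).castSucc = ⟨i, by omega⟩ from rfl,
      show (⟨i, hi⟩ : Fin P.n).succ = ⟨i + 1, by omega⟩ from rfl, v_eq, v_eq] at h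
  · rintro ⟨i, hi, h⟩
    refine ⟨⟨i, hi⟩, ?_⟩
    rwa [show (⟨i, hi⟩ : Fin P.n).castSucc = ⟨i, by omega⟩ from rfl,
      show (⟨i, hi⟩ : Fin P.n).succ = ⟨i + 1, by omega⟩ from rfl, v_eq, v_eq]

theorem vertex_mem_graph (P : LatticePath m e) (hn : 0 < P.n) {i : ℕ} (hi : i ≤ P.n) :
    ((P.xCoord i : ℝ), (P.yCoord i : ℝ)) ∈ P.graph := by
  rw [mem_graph_iff]
  rcases Nat.lt_or_ge i P.n with h | h
  · have : (P.xCoord i : ℝ) < P.xCoord (i + 1) := by exact_mod_cast P.xCoord_lt_succ h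
    exact ⟨i, h, le_rfl, this.le, by ring⟩
  · obtain ⟨j, rfl⟩ : ∃ j, i = j + 1 := ⟨i - 1, by omega⟩
    have : (P.xCoord j : ℝ) < P.xCoord (j + 1) := by exact_mod_cast P.xCoord_lt_succ (by omega)
    exact ⟨j, by omega, this.le, le_rfl, by ring⟩

theorem exists_mem_graph_of_edge (P : LatticePath m e) {i : ℕ} (hi : i < P.n) {x : ℝ}
    (h0 : (P.xCoord i : ℝ) ≤ x) (h1 : x ≤ P.xCoord (i + 1)) :
    ∃ y, (x, y) ∈ P.graph ∧ (y - P.yCoord i) * (P.xCoord (i + 1) - P.xCoord i) =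
      (x - P.xCoord i) * (P.yCoord (i + 1) - P.yCoord i) := by
  have hlt : (P.xCoord i : ℝ) < P.xCoord (i + 1) := by exact_mod_cast P.xCoord_lt_succ hi
  have heq : ((x - P.xCoord i) * (P.yCoord (i + 1) - P.yCoord i) /
      (P.xCoord (i + 1) - P.xCoord i) + P.yCoord i - P.yCoord i) *
      (P.xCoord (i + 1) - P.xCoord i) =
      (x - P.xCoord i) * (P.yCoord (i + 1) - P.yCoord i) := by
    rw [add_sub_cancel_right, div_mul_cancel₀ _ (sub_pos.2 hlt).ne']
  exact ⟨_, (P.mem_graph_iff _ _).2 ⟨i, hi, h0, h1, heq⟩, heq⟩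

theorem le_mul_of_mem_graph (P : LatticePath m e) {θ : ℝ}
    (h : ∀ i ≤ P.n, (P.yCoord i : ℝ) ≤ θ * P.xCoord i) : ∀ p ∈ P.graph, p.2 ≤ θ * p.1 := by
  rintro ⟨x, y⟩ hp
  obtain ⟨i, hi, h0, h1, h2⟩ := (P.mem_graph_iff x y).1 hp
  have hlt : (P.xCoord i : ℝ) < P.xCoord (i + 1) := by exact_mod_cast P.xCoord_lt_succ hi
  have h3 := mul_nonneg (sub_nonneg.2 h1) (sub_nonneg.2 (h i hi.le))
  have h4 := mul_nonneg (sub_nonneg.2 h0) (sub_nonneg.2 (h (i + 1) hi))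
  exact le_of_mul_le_mul_right (by linarith) (sub_pos.2 hlt)

theorem latticeXs_subset (P : LatticePath m e) : latticeXs P.graph ⊆ Icc 0 (m : ℤ) := by
  rintro x ⟨y, hy⟩
  obtain ⟨i, hi, h0, h1, -⟩ := (P.mem_graph_iff _ _).1 hy
  have h2 := P.xCoord_le (Nat.zero_le i) hi.le
  have h3 := P.xCoord_le (Nat.succ_le_of_lt hi) le_rfl
  rw [P.coords_zero.1] at h2
  rw [P.coords_last.1] at h3
  exact ⟨h2.trans (by exact_mod_cast h0), le_trans (by exact_mod_cast h1) h3⟩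

/-- Every integer abscissa other than the last one lies over a half-open edge. -/
theorem exists_edge (P : LatticePath m e) {a : ℤ} (h0 : 0 ≤ a) (h1 : a < m) :
    ∃ i < P.n, P.xCoord i ≤ a ∧ a < P.xCoord (i + 1) := by
  by_contra! h
  have key : ∀ i ≤ P.n, P.xCoord i ≤ a := by
    intro i
    induction i with
    | zero => intro _; rwa [P.coords_zero.1]
    | succ i ih => exact fun hi => h i hi (ih (by omega))
  have := key P.n le_rfl
  rw [P.coords_last.1] at this
  omega

/-- On a concave path, the edges after an edge of slope `s` have slope at most `s`. -/
theorem IsConcave.edge_le {P : LatticePath m e} (hP : P.IsConcave) {s : ℤ} {i j : ℕ}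
    (hs : P.yCoord (i + 1) - P.yCoord i ≤ s * (P.xCoord (i + 1) - P.xCoord i))
    (hij : i ≤ j) (hj : j < P.n) :
    P.yCoord (j + 1) - P.yCoord j ≤ s * (P.xCoord (j + 1) - P.xCoord j) := by
  induction j, hij using Nat.le_induction with
  | base => exact hs
  | succ j _ ih =>
    have h0 := P.xCoord_lt_succ (i := j) (by omega)
    have h1 := P.xCoord_lt_succ hj
    have h2 := (P.isConcave_iff.1 hP) j (by omega)
    refine le_of_mul_le_mul_right ?_ (sub_pos.2 h0)
    nlinarith [ih (by omega)]

/-- On a concave path, the vertices up to the end of an edge of slope `s` lie on or above the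
line of slope `s` through the origin. -/
theorem IsConcave.le_yCoord {P : LatticePath m e} (hP : P.IsConcave) {s : ℤ} {i : ℕ}
    (hi : i < P.n)
    (hs : s * (P.xCoord (i + 1) - P.xCoord i) ≤ P.yCoord (i + 1) - P.yCoord i)
    {j : ℕ} (hj : j ≤ i + 1) : s * P.xCoord j ≤ P.yCoord j := by
  have edge : ∀ l ≤ i, s * (P.xCoord (l + 1) - P.xCoord l) ≤ P.yCoord (l + 1) - P.yCoord l := by
    intro l hl
    induction hl using Nat.decreasingInduction with
    | self => exact hs
    | of_succ l hl ih =>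
      have h0 := P.xCoord_lt_succ (i := l) (by omega)
      have h1 := P.xCoord_lt_succ (i := l + 1) (by omega)
      have h2 := (P.isConcave_iff.1 hP) l (by omega)
      refine le_of_mul_le_mul_right ?_ (sub_pos.2 h1)
      nlinarith
  induction j with
  | zero => simp [P.coords_zero]
  | succ j ih => linarith [edge j (by omega), ih (by omega)]

/-- The path with vertices `(0, 0)`, `(a, b)` and `(m, e)`. -/
def twoEdges {a : ℤ} (b : ℤ) (h0 : 0 < a) (h1 : a < m) : LatticePath m e where
  n := 2
  v := ![(0, 0), (a, b), ((m : ℤ), e)]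
  first := rfl
  last := rfl
  mono i := by fin_cases i <;> simpa

theorem mem_graph_twoEdges {a b : ℤ} (h0 : 0 < a) (h1 : a < m) :
    ((a : ℝ), (b : ℝ)) ∈ (twoEdges (e := e) b h0 h1).graph :=
  (twoEdges (e := e) b h0 h1).vertex_mem_graph (i := 1) Nat.zero_lt_two one_le_two

/-- The mirror image of a path in the horizontal axis. -/
def reflect (P : LatticePath m e) {e' : ℤ} (h : e' = -e) : LatticePath m e' where
  n := P.n
  v i := ((P.v i).1, -(P.v i).2)
  first := by simp [P.first]
  last := by simp [P.last, h]
  mono := P.mono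

theorem mem_graph_reflect (P : LatticePath m e) {e' : ℤ} (h : e' = -e) (x y : ℝ) :
    (x, y) ∈ (P.reflect h).graph ↔ (x, -y) ∈ P.graph := by
  simp only [mem_graph_iff]
  refine exists_congr fun i => and_congr Iff.rfl (and_congr Iff.rfl (and_congr Iff.rfl ?_))
  simp only [reflect, xCoord, yCoord]
  push_cast
  constructor <;> intro h <;> linarith

theorem isConcave_reflect (P : LatticePath m e) {e' : ℤ} (h : e' = -e) :
    (P.reflect h).IsConcave ↔ P.IsConvex := by
  refine forall₂_congr fun i hi => ?_
  simp only [reflect]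
  constructor <;> intro h <;> linarith

theorem isConvex_reflect (P : LatticePath m e) {e' : ℤ} (h : e' = -e) :
    (P.reflect h).IsConvex ↔ P.IsConcave := by
  refine forall₂_congr fun i hi => ?_
  simp only [reflect]
  constructor <;> intro h <;> linarith

theorem pathPartition_reflect (P : LatticePath m e) {e' : ℤ} (h : e' = -e) :
    pathPartition (P.reflect h) = pathPartition P := by
  unfold pathPartition
  congr 1
  ext x
  simp only [latticeXs, mem_ofPred_eq, mem_graph_reflect]
  exact ⟨fun ⟨y, hy⟩ => ⟨-y, by simpa using hy⟩, fun ⟨y, hy⟩ => ⟨-y, by simpa using hy⟩⟩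

end LatticePath

theorem one_mem_zipWith_tail {l : List ℤ} (hl : l.Pairwise (· < ·)) {a : ℤ} (h0 : a ∈ l)
    (h1 : a + 1 ∈ l) : (1 : ℤ) ∈ List.zipWith (fun a b => b - a) l l.tail := by
  induction l with
  | nil => simp at h0
  | cons x t ih =>
    cases t with
    | nil => simp at h0 h1; omega
    | cons y t =>
      have ih := ih hl.of_cons
      simp only [List.tail_cons, List.zipWith_cons_cons, List.mem_cons, List.pairwise_cons]
        at h0 h1 hl ih ⊢
      have hxy := hl.1 y (Or.inl rfl)
      grind

theorem one_mem_setGaps_iff {X : Set ℤ} (hX : X.Finite) :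
    (1 : ℤ) ∈ setGaps X ↔ ∃ a ∈ X, a + 1 ∈ X := by
  rw [setGaps, dif_pos hX, Multiset.mem_coe]
  constructor
  · intro h
    obtain ⟨i, hi, h⟩ := List.mem_iff_getElem.1 h
    simp only [List.length_zipWith, List.length_tail, lt_inf_iff] at hi
    simp only [List.getElem_zipWith, List.getElem_tail] at h
    have mem : ∀ (j : ℕ) (hj : j < (hX.toFinset.sort (· ≤ ·)).length),
        (hX.toFinset.sort (· ≤ ·))[j] ∈ X := fun j hj => by
      simpa only [Finset.mem_sort, Finite.mem_toFinset] using List.getElem_mem hj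
    refine ⟨_, mem i hi.1, ?_⟩
    convert mem (i + 1) (by omega) using 1
    linarith
  · rintro ⟨a, h0, h1⟩
    exact one_mem_zipWith_tail (a := a) (Finset.sortedLT_sort _).pairwise (by simpa) (by simpa)

theorem one_mem_pathPartition_iff_exists {m : ℕ} {e : ℤ} (P : LatticePath m e) :
    (1 : ℤ) ∈ pathPartition P ↔ ∃ a ∈ latticeXs P.graph, a + 1 ∈ latticeXs P.graph :=
  one_mem_setGaps_iff ((finite_Icc _ _).subset P.latticeXs_subset)

theorem floor_sub_one_mul_add_floor_le (θ x : ℝ) : ⌊(x - 1) * θ⌋ + ⌊θ⌋ ≤ ⌊x * θ⌋ := by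
  rw [show x * θ = (x - 1) * θ + θ by ring]
  exact Int.le_floor_add _ _

theorem posPath_twoEdges {θ : ℝ} {m : ℕ} (h0 : (0 : ℤ) < m - 1) (h1 : (m : ℤ) - 1 < m)
    (h : ⌊(m : ℝ) * θ⌋ = ⌊((m : ℝ) - 1) * θ⌋ + ⌊θ⌋) :
    PosPath θ m (LatticePath.twoEdges ⌊((m : ℝ) - 1) * θ⌋ h0 h1) := by
  constructor
  · have hk : ((m : ℤ) - 1) * ⌊θ⌋ ≤ ⌊((m : ℝ) - 1) * θ⌋ := by
      rw [Int.le_floor]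
      push_cast
      exact mul_le_mul_of_nonneg_left (Int.floor_le θ) (by exact_mod_cast h0.le)
    intro i hi
    obtain rfl : i = 0 := by simp only [LatticePath.twoEdges] at hi; omega
    change (⌊(m : ℝ) * θ⌋ - ⌊((m : ℝ) - 1) * θ⌋) * ((m : ℤ) - 1 - 0) ≤
      (⌊((m : ℝ) - 1) * θ⌋ - 0) * ((m : ℤ) - (m - 1))
    rw [h]
    linarith
  · apply LatticePath.le_mul_of_mem_graph
    intro i hi
    change i ≤ 2 at hi
    interval_cases i
    · change (((0 : ℤ)) : ℝ) ≤ θ * ((0 : ℤ) : ℝ)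
      simp
    · change ((⌊((m : ℝ) - 1) * θ⌋ : ℤ) : ℝ) ≤ θ * (((m : ℤ) - 1 : ℤ) : ℝ)
      push_cast
      linarith [Int.floor_le (((m : ℝ) - 1) * θ)]
    · change ((⌊(m : ℝ) * θ⌋ : ℤ) : ℝ) ≤ θ * ((m : ℤ) : ℝ)
      push_cast
      linarith [Int.floor_le ((m : ℝ) * θ)]

theorem one_mem_pathPartition_iff {θ : ℝ} {m : ℕ} (hm : 2 ≤ m)
    {P : LatticePath m ⌊(m : ℝ) * θ⌋} (hP : IsMaxPosPath θ m P) :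
    (1 : ℤ) ∈ pathPartition P ↔ ⌊(m : ℝ) * θ⌋ = ⌊((m : ℝ) - 1) * θ⌋ + ⌊θ⌋ := by
  obtain ⟨⟨hconc, hbelow⟩, hmax⟩ := hP
  have huniq {x y y' : ℝ} (h : (x, y) ∈ P.graph) (h' : (x, y') ∈ P.graph) : y = y' :=
    le_antisymm (hmax P ⟨hconc, hbelow⟩ x y y' h h') (hmax P ⟨hconc, hbelow⟩ x y' y h' h)
  obtain ⟨hxn, hyn⟩ := P.coords_last
  have hn : 0 < P.n := by
    by_contra! h
    rw [Nat.le_zero.1 h, P.coords_zero.1] at hxn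
    omega
  have hlast := P.vertex_mem_graph hn le_rfl
  rw [hxn, hyn] at hlast
  obtain ⟨l, hl⟩ : ∃ l, P.n = l + 1 := ⟨P.n - 1, by omega⟩
  have hlx := P.xCoord_lt_succ (i := l) (by omega)
  rw [hl] at hxn hyn
  have hlxR : (P.xCoord l : ℝ) + 1 ≤ m := by
    rw [hxn] at hlx
    exact_mod_cast hlx
  obtain ⟨y, hymem, hy⟩ := P.exists_mem_graph_of_edge (i := l) (x := m - 1) (by omega)
    (by linarith) (by rw [hxn]; push_cast; linarith)
  have hybelow : y ≤ θ * (m - 1) := hbelow _ hymem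
  rw [hxn, hyn, Int.cast_natCast] at hy
  have hdrop : (⌊(m : ℝ) * θ⌋ - y) * (m - P.xCoord l) = ⌊(m : ℝ) * θ⌋ - P.yCoord l := by
    linarith
  have hpos : (0 : ℝ) < m - P.xCoord l := by linarith
  rw [one_mem_pathPartition_iff_exists]
  constructor
  · rintro ⟨a, ha, ha'⟩
    have ha0 := (P.latticeXs_subset ha).1
    have ham := (P.latticeXs_subset ha').2
    obtain ⟨u, hu⟩ := ha
    obtain ⟨w, hw⟩ := ha'
    obtain ⟨i, hi, hia, hai⟩ := P.exists_edge ha0 (by omega)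
    obtain ⟨u', hu', hue⟩ := P.exists_mem_graph_of_edge hi (x := a) (by exact_mod_cast hia)
      (by exact_mod_cast hai.le)
    obtain ⟨w', hw', hwe⟩ := P.exists_mem_graph_of_edge hi (x := (a + 1 : ℤ))
      (by exact_mod_cast hia.trans (by omega)) (by exact_mod_cast hai)
    obtain rfl := huniq hu hu'
    obtain rfl := huniq hw hw'
    have hs : P.yCoord (i + 1) - P.yCoord i = (w - u) * (P.xCoord (i + 1) - P.xCoord i) := by
      push_cast at hwe
      have : (P.yCoord (i + 1) - P.yCoord i : ℝ) =
          (w - u) * (P.xCoord (i + 1) - P.xCoord i) := by linarith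
      exact_mod_cast this
    have hsfloor : w - u ≤ ⌊θ⌋ := by
      rw [Int.le_floor]
      have h0 : ((w - u : ℤ) : ℝ) * P.xCoord (i + 1) ≤ P.yCoord (i + 1) := by
        exact_mod_cast hconc.le_yCoord hi hs.ge le_rfl
      have h1 := hbelow _ (P.vertex_mem_graph hn (i := i + 1) hi)
      have h2 : (0 : ℝ) < P.xCoord (i + 1) := by exact_mod_cast ha0.trans_lt hai
      exact le_of_mul_le_mul_right (h0.trans h1) h2
    have hedge := hconc.edge_le hs.le (j := l) (by omega) (by omega)
    rw [hxn, hyn] at hedge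
    have hedgeR : (⌊(m : ℝ) * θ⌋ - P.yCoord l : ℝ) ≤ (w - u) * (m - P.xCoord l) := by
      exact_mod_cast hedge
    have hle : (⌊(m : ℝ) * θ⌋ - y : ℝ) ≤ w - u :=
      le_of_mul_le_mul_right (hdrop.trans_le hedgeR) hpos
    have hfloor : ⌊(m : ℝ) * θ⌋ - (w - u) ≤ ⌊((m : ℝ) - 1) * θ⌋ := by
      rw [Int.le_floor]
      push_cast
      linarith
    have := floor_sub_one_mul_add_floor_le θ m
    omega
  · intro h
    have h0 : (0 : ℤ) < m - 1 := by omega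
    have h1 : (m : ℤ) - 1 < m := by omega
    have hge : (⌊((m : ℝ) - 1) * θ⌋ : ℝ) ≤ y := by
      refine hmax _ (posPath_twoEdges h0 h1 h) _ _ _ (LatticePath.mem_graph_twoEdges h0 h1) ?_
      push_cast
      exact hymem
    have hvertex : P.yCoord l + ⌊θ⌋ * (m - P.xCoord l) ≤ ⌊(m : ℝ) * θ⌋ := by
      rw [Int.le_floor]
      push_cast
      have h2 := hbelow _ (P.vertex_mem_graph hn (i := l) (by omega))
      have h3 := mul_le_mul_of_nonneg_right (Int.floor_le θ) hpos.le
      dsimp only at h2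
      linarith
    have hvertexR : (P.yCoord l + ⌊θ⌋ * (m - P.xCoord l) : ℝ) ≤ ⌊(m : ℝ) * θ⌋ := by
      exact_mod_cast hvertex
    have hle : (⌊θ⌋ : ℝ) ≤ ⌊(m : ℝ) * θ⌋ - y :=
      le_of_mul_le_mul_right (by linarith) hpos
    have hyeq : y = ⌊((m : ℝ) - 1) * θ⌋ := by
      have : (⌊(m : ℝ) * θ⌋ : ℝ) = ⌊((m : ℝ) - 1) * θ⌋ + ⌊θ⌋ := by exact_mod_cast h
      linarith
    refine ⟨m - 1, ⟨⌊((m : ℝ) - 1) * θ⌋, ?_⟩, ⟨⌊(m : ℝ) * θ⌋, ?_⟩⟩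
    · rw [← hyeq]
      push_cast
      exact hymem
    · rwa [sub_add_cancel]

theorem isMaxPosPath_reflect {θ : ℝ} {m : ℕ} {Q : LatticePath m ⌈(m : ℝ) * θ⌉}
    (hQ : IsMinNegPath θ m Q) (h : ⌊(m : ℝ) * -θ⌋ = -⌈(m : ℝ) * θ⌉) :
    IsMaxPosPath (-θ) m (Q.reflect h) := by
  obtain ⟨⟨hconv, habove⟩, hmin⟩ := hQ
  refine ⟨⟨(Q.isConcave_reflect h).2 hconv, ?_⟩, ?_⟩
  · rintro ⟨x, y⟩ hp
    have := habove _ ((Q.mem_graph_reflect h x y).1 hp)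
    dsimp at this ⊢
    linarith
  · rintro R ⟨hR, hRb⟩ x y y' hy hy'
    have h' : ⌈(m : ℝ) * θ⌉ = -⌊(m : ℝ) * -θ⌋ := by omega
    have := hmin (R.reflect h') ⟨(R.isConvex_reflect h').2 hR, ?_⟩ x (-y') (-y)
      ((Q.mem_graph_reflect h x y').1 hy') ((R.mem_graph_reflect h' x (-y)).2 (by simpa))
    · linarith
    · rintro ⟨x, y⟩ hp
      have := hRb _ ((R.mem_graph_reflect h' x y).1 hp)
      dsimp at this ⊢
      linarith

theorem Irrational.ceil_eq_floor_add_one {x : ℝ} (hx : Irrational x) : ⌈x⌉ = ⌊x⌋ + 1 := by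
  rw [Int.ceil_eq_iff]
  push_cast
  exact ⟨by linarith [(Int.floor_le x).lt_of_ne fun h => hx ⟨⌊x⌋, by exact_mod_cast h⟩],
    (Int.lt_floor_add_one x).le⟩

/-- For irrational `θ` and `m ≥ 2`, `1` is a part of
`p⁺_θ(m)` if and only if `1` is not a part of `p⁻_θ(m)`. -/
theorem statement3 (θ : ℝ) (hθ : Irrational θ) (m : ℕ) (hm : 2 ≤ m) :
    ∀ (P : LatticePath m ⌊(m : ℝ) * θ⌋) (Q : LatticePath m ⌈(m : ℝ) * θ⌉),
      IsMaxPosPath θ m P → IsMinNegPath θ m Q →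
      ((1 : ℤ) ∈ pathPartition P ↔ (1 : ℤ) ∉ pathPartition Q) := by
  intro P Q hP hQ
  have hneg : ⌊(m : ℝ) * -θ⌋ = -⌈(m : ℝ) * θ⌉ := by rw [mul_neg, Int.floor_neg]
  rw [one_mem_pathPartition_iff hm hP, ← Q.pathPartition_reflect hneg,
    one_mem_pathPartition_iff hm (isMaxPosPath_reflect hQ hneg)]
  have h0 := hθ.ceil_eq_floor_add_one
  have h1 := (hθ.natCast_mul (m := m) (by omega)).ceil_eq_floor_add_one
  have h2 := (hθ.natCast_mul (m := m - 1) (by omega)).ceil_eq_floor_add_one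
  rw [Nat.cast_sub (by omega), Nat.cast_one] at h2
  have h3 := floor_sub_one_mul_add_floor_le θ m
  have h4 := Int.le_floor_add_floor (((m : ℝ) - 1) * θ) θ
  rw [show ((m : ℝ) - 1) * θ + θ = m * θ by ring] at h4
  rw [mul_neg, mul_neg, Int.floor_neg, Int.floor_neg, Int.floor_neg]
  omega
end

section
/- Let θ be an irrational real number and let m > 1 be an integer. Then the partitions p⁺_θ(m) and p⁻_θ(m) are disjoint: no positive integer occurs both as a part of p⁺_θ(m) and as a part of p⁻_θ(m). -/
open Set

/-- A gap of a set of integers is the difference of two members with no member between them. -/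
lemma exists_of_mem_setGaps {X : Set ℤ} {a : ℤ} (h : a ∈ setGaps X) :
    ∃ x ∈ X, x + a ∈ X ∧ ∀ z ∈ X, x < z → x + a ≤ z := by
  classical
  unfold setGaps at h
  split_ifs at h with hX
  · set l := hX.toFinset.sort (· ≤ ·) with hl
    have hmem : ∀ z, z ∈ l ↔ z ∈ X := fun z => by simp [hl]
    have hs : l.SortedLT := Finset.sortedLT_sort _
    rw [Multiset.mem_coe, List.mem_iff_getElem] at h
    obtain ⟨i, hi, rfl⟩ := h
    have hi' : i + 1 < l.length := by
      simp only [List.length_zipWith, List.length_tail] at hi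
      omega
    refine ⟨l[i], (hmem _).1 (List.getElem_mem _), ?_⟩
    simp only [List.getElem_zipWith, List.getElem_tail, add_sub_cancel]
    refine ⟨(hmem _).1 (List.getElem_mem _), ?_⟩
    intro z hz hlt
    obtain ⟨j, hj, rfl⟩ := List.mem_iff_getElem.1 ((hmem z).2 hz)
    have hij : i < j := (hs.getElem_lt_getElem_iff).1 hlt
    exact (hs.getElem_le_getElem_iff).2 hij
  · simp at h

/-- A point of a segment in the plane, in coordinates. -/
lemma mem_segment_latticeToR {p q : ℤ × ℤ} {z : ℝ × ℝ} :
    z ∈ segment ℝ (latticeToR p) (latticeToR q) ↔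
      ∃ s t : ℝ, 0 ≤ s ∧ 0 ≤ t ∧ s + t = 1 ∧
        s * p.1 + t * q.1 = z.1 ∧ s * p.2 + t * q.2 = z.2 := by
  simp [segment, latticeToR, Prod.ext_iff]

/-- A sequence of points whose successive slopes decrease lies below the line through any two
consecutive ones. -/
lemma le_line_of_slopes_antitone {n : ℕ} {X Y : ℕ → ℝ} (hX : ∀ i < n, X i < X (i + 1))
    (hY : ∀ i, i + 2 ≤ n → (Y (i + 2) - Y (i + 1)) * (X (i + 1) - X i) ≤
      (Y (i + 1) - Y i) * (X (i + 2) - X (i + 1)))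
    {i j : ℕ} (hi : i < n) (hj : j ≤ n) :
    Y j ≤ Y i + (Y (i + 1) - Y i) / (X (i + 1) - X i) * (X j - X i) := by
  set s : ℕ → ℝ := fun k => (Y (k + 1) - Y k) / (X (k + 1) - X k) with hs
  have hstep : ∀ k < n, Y (k + 1) = Y k + s k * (X (k + 1) - X k) := by
    intro k hk
    have := sub_pos.2 (hX k hk)
    simp only [hs]
    field_simp
    ring
  have hanti : ∀ k l, k ≤ l → l < n → s l ≤ s k := by
    intro k l hkl
    induction l, hkl using Nat.le_induction with
    | base => intro _; exact le_rfl
    | succ l hkl ih =>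
      intro hl
      refine le_trans ?_ (ih (by omega))
      have h1 := sub_pos.2 (hX l (by omega))
      have h2 := sub_pos.2 (hX (l + 1) hl)
      exact (div_le_div_iff₀ h2 h1).2 (hY l (by omega))
  change Y j ≤ Y i + s i * (X j - X i)
  rcases le_total i j with hij | hij
  · induction j, hij using Nat.le_induction with
    | base => simp
    | succ l hkl ih =>
      have h1 := sub_pos.2 (hX l (by omega))
      have h2 := hanti i l hkl (by omega)
      have h3 := hstep l (by omega)
      have h4 := ih (by omega)
      nlinarith [mul_le_mul_of_nonneg_right h2 h1.le]
  · induction hij using Nat.decreasingInduction with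
    | self => simp
    | of_succ l hkl ih =>
      have h1 := sub_pos.2 (hX l (by omega))
      have h2 := hanti l i hkl.le hi
      have h3 := hstep l (by omega)
      have h4 := ih (by omega)
      nlinarith [mul_le_mul_of_nonneg_right h2 h1.le]

namespace LatticePath

variable {m : ℕ} {e : ℤ}

/-- The vertices of a path, extended constantly to all natural indices. -/
def vertex (P : LatticePath m e) (k : ℕ) : ℤ × ℤ := P.v ⟨min k P.n, by omega⟩

lemma vertex_eq (P : LatticePath m e) {k : ℕ} (hk : k ≤ P.n) :
    P.vertex k = P.v ⟨k, by omega⟩ := by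
  simp [vertex, hk]

lemma vertex_zero (P : LatticePath m e) : P.vertex 0 = (0, 0) := by
  rw [vertex_eq P (Nat.zero_le _), ← P.first]
  rfl

lemma vertex_n (P : LatticePath m e) : P.vertex P.n = ((m : ℤ), e) := by
  rw [vertex_eq P le_rfl, ← P.last]
  rfl

lemma vertex_lt (P : LatticePath m e) {k : ℕ} (hk : k < P.n) :
    (P.vertex k).1 < (P.vertex (k + 1)).1 := by
  rw [vertex_eq P hk.le, vertex_eq P hk]
  exact P.mono ⟨k, hk⟩

lemma n_pos (P : LatticePath m e) (hm : 0 < m) : 0 < P.n := by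
  by_contra h
  have h1 := P.vertex_n
  rw [show P.n = 0 by omega, vertex_zero, Prod.mk.injEq] at h1
  omega

lemma mem_graph {P : LatticePath m e} {z : ℝ × ℝ} :
    z ∈ P.graph ↔ ∃ k < P.n, z ∈ segment ℝ (latticeToR (P.vertex k))
      (latticeToR (P.vertex (k + 1))) := by
  simp only [graph, mem_iUnion]
  constructor
  · rintro ⟨i, hi⟩
    refine ⟨i, i.2, ?_⟩
    rw [vertex_eq P i.2.le, vertex_eq P i.2]
    exact hi
  · rintro ⟨k, hk, h⟩
    refine ⟨⟨k, hk⟩, ?_⟩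
    rw [vertex_eq P hk.le, vertex_eq P hk] at h
    exact h

lemma latticeToR_vertex_mem_graph (P : LatticePath m e) (hm : 0 < m) {k : ℕ} (hk : k ≤ P.n) :
    latticeToR (P.vertex k) ∈ P.graph := by
  have := P.n_pos hm
  rw [mem_graph]
  rcases hk.lt_or_eq with h | rfl
  · exact ⟨k, h, left_mem_segment ..⟩
  · refine ⟨P.n - 1, by omega, ?_⟩
    rw [show P.n - 1 + 1 = P.n by omega]
    exact right_mem_segment ..

lemma zero_mem_graph (P : LatticePath m e) (hm : 0 < m) : ((0 : ℝ), (0 : ℝ)) ∈ P.graph := by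
  simpa [vertex_zero, latticeToR] using P.latticeToR_vertex_mem_graph hm (Nat.zero_le _)

lemma last_mem_graph (P : LatticePath m e) (hm : 0 < m) : ((m : ℝ), (e : ℝ)) ∈ P.graph := by
  simpa [vertex_n, latticeToR] using P.latticeToR_vertex_mem_graph hm le_rfl

lemma vertex_fst_mono (P : LatticePath m e) {k l : ℕ} (hkl : k ≤ l) (hl : l ≤ P.n) :
    (P.vertex k).1 ≤ (P.vertex l).1 := by
  induction l, hkl using Nat.le_induction with
  | base => exact le_rfl
  | succ l _ ih => exact (ih (by omega)).trans (P.vertex_lt (by omega)).le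

lemma fst_mem_Icc (P : LatticePath m e) {z : ℝ × ℝ} (hz : z ∈ P.graph) :
    z.1 ∈ Icc (0 : ℝ) m := by
  obtain ⟨k, hk, h⟩ := mem_graph.1 hz
  obtain ⟨s, t, hs, ht, hst, hx, -⟩ := mem_segment_latticeToR.1 h
  have h1 := P.vertex_fst_mono (Nat.zero_le k) hk.le
  have h2 := P.vertex_lt hk
  have h3 := P.vertex_fst_mono (Nat.succ_le_of_lt hk) le_rfl
  rw [vertex_zero] at h1
  rw [vertex_n] at h3
  have h1' : (0 : ℝ) ≤ (P.vertex k).1 := by exact_mod_cast h1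
  have h2' : ((P.vertex k).1 : ℝ) < (P.vertex (k + 1)).1 := by exact_mod_cast h2
  have h3' : ((P.vertex (k + 1)).1 : ℝ) ≤ m := by exact_mod_cast h3
  rw [← hx]
  obtain rfl : s = 1 - t := by linarith
  constructor <;> nlinarith

lemma exists_mem_graph (P : LatticePath m e) (hm : 0 < m) {x : ℝ} (hx : x ∈ Icc (0 : ℝ) m) :
    ∃ y, (x, y) ∈ P.graph := by
  have key : ∀ k ≤ P.n, x ≤ (P.vertex k).1 → ∃ y, (x, y) ∈ P.graph := by
    intro k
    induction k with
    | zero =>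
      intro _ h
      obtain rfl : x = 0 := le_antisymm (by simpa [vertex_zero] using h) hx.1
      exact ⟨0, P.zero_mem_graph hm⟩
    | succ k ih =>
      intro hk h
      rcases le_total x (P.vertex k).1 with h1 | h1
      · exact ih (by omega) h1
      · have h2 : (0 : ℝ) < (P.vertex (k + 1)).1 - (P.vertex k).1 :=
          sub_pos.2 (by exact_mod_cast P.vertex_lt hk)
        refine ⟨_, mem_graph.2 ⟨k, hk, mem_segment_latticeToR.2
          ⟨((P.vertex (k + 1)).1 - x) / ((P.vertex (k + 1)).1 - (P.vertex k).1),
            (x - (P.vertex k).1) / ((P.vertex (k + 1)).1 - (P.vertex k).1),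
            div_nonneg (by linarith) h2.le, div_nonneg (by linarith) h2.le, ?_, ?_, rfl⟩⟩⟩
        · field_simp
          ring
        · field_simp
          ring
  exact key P.n le_rfl (by simpa [vertex_n] using hx.2)

/-- A concave path lies below the line supporting any of its edges. -/
lemma IsConcave.graph_le_line {P : LatticePath m e} (hP : P.IsConcave) {i : ℕ} (hi : i < P.n)
    {z : ℝ × ℝ} (hz : z ∈ P.graph) :
    z.2 ≤ (P.vertex i).2 + (((P.vertex (i + 1)).2 : ℝ) - (P.vertex i).2) /
      ((P.vertex (i + 1)).1 - (P.vertex i).1) * (z.1 - (P.vertex i).1) := by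
  have hX : ∀ k < P.n, ((P.vertex k).1 : ℝ) < (P.vertex (k + 1)).1 := fun k hk => by
    exact_mod_cast P.vertex_lt hk
  have hY : ∀ k, k + 2 ≤ P.n →
      (((P.vertex (k + 2)).2 : ℝ) - (P.vertex (k + 1)).2) *
        ((P.vertex (k + 1)).1 - (P.vertex k).1) ≤
      ((P.vertex (k + 1)).2 - (P.vertex k).2) *
        ((P.vertex (k + 2)).1 - (P.vertex (k + 1)).1) := by
    intro k hk
    have := hP k hk
    rw [← vertex_eq P hk, ← vertex_eq P (show k + 1 ≤ P.n by omega),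
      ← vertex_eq P (show k ≤ P.n by omega)] at this
    exact_mod_cast this
  have key := fun j => le_line_of_slopes_antitone (X := fun k => ((P.vertex k).1 : ℝ))
    (Y := fun k => ((P.vertex k).2 : ℝ)) hX hY (j := j) hi
  obtain ⟨k, hk, h⟩ := mem_graph.1 hz
  obtain ⟨s, t, hs, ht, hst, hx, hy⟩ := mem_segment_latticeToR.1 h
  have h1 := mul_le_mul_of_nonneg_left (key k hk.le) hs
  have h2 := mul_le_mul_of_nonneg_left (key (k + 1) hk) ht
  rw [← hx, ← hy]
  obtain rfl : s = 1 - t := by linarith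
  nlinarith

/-- A concave path has a supporting line at each of its points. -/
lemma IsConcave.exists_support {P : LatticePath m e} (hP : P.IsConcave) {z : ℝ × ℝ}
    (hz : z ∈ P.graph) : ∃ c : ℝ, ∀ w ∈ P.graph, w.2 ≤ z.2 + c * (w.1 - z.1) := by
  obtain ⟨k, hk, h⟩ := mem_graph.1 hz
  obtain ⟨s, t, hs, ht, hst, hx, hy⟩ := mem_segment_latticeToR.1 h
  refine ⟨(((P.vertex (k + 1)).2 : ℝ) - (P.vertex k).2) /
    ((P.vertex (k + 1)).1 - (P.vertex k).1), fun w hw => (hP.graph_le_line hk hw).trans_eq ?_⟩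
  have h2 : (0 : ℝ) < (P.vertex (k + 1)).1 - (P.vertex k).1 :=
    sub_pos.2 (by exact_mod_cast P.vertex_lt hk)
  rw [← hx, ← hy]
  obtain rfl : s = 1 - t := by linarith
  field_simp
  ring

lemma IsConcave.chord_le {P : LatticePath m e} (hP : P.IsConcave) {u p v yu yp yv : ℝ}
    (hu : (u, yu) ∈ P.graph) (hp : (p, yp) ∈ P.graph) (hv : (v, yv) ∈ P.graph)
    (hup : u ≤ p) (hpv : p ≤ v) : yv * (p - u) + yu * (v - p) ≤ yp * (v - u) := by
  obtain ⟨c, hc⟩ := hP.exists_support hp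
  have h1 := mul_le_mul_of_nonneg_right (hc _ hu) (sub_nonneg.2 hpv)
  have h2 := mul_le_mul_of_nonneg_right (hc _ hv) (sub_nonneg.2 hup)
  simp only at h1 h2
  nlinarith

lemma IsConcave.add_le_add {P : LatticePath m e} (hP : P.IsConcave)
    {u p q v yu yp yq yv : ℝ} (hu : (u, yu) ∈ P.graph) (hp : (p, yp) ∈ P.graph)
    (hq : (q, yq) ∈ P.graph) (hv : (v, yv) ∈ P.graph) (hup : u ≤ p) (hpv : p ≤ v)
    (huv : u < v) (h : p + q = u + v) : yu + yv ≤ yp + yq := by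
  have h1 := hP.chord_le hu hp hv hup hpv
  have h2 := hP.chord_le hu hq hv (by linarith) (by linarith)
  obtain rfl : q = u + v - p := by linarith
  have : 0 < v - u := sub_pos.2 huv
  refine le_of_mul_le_mul_right ?_ this
  nlinarith

/-- The reflection of a path in the horizontal axis. -/
def neg (P : LatticePath m e) {e' : ℤ} (h : e' = -e) : LatticePath m e' where
  n := P.n
  v i := ((P.v i).1, -(P.v i).2)
  first := by simp [P.first]
  last := by simp [P.last, h]
  mono := P.mono

lemma mem_graph_neg {P : LatticePath m e} {e' : ℤ} (h : e' = -e) {x y : ℝ} :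
    (x, y) ∈ (P.neg h).graph ↔ (x, -y) ∈ P.graph := by
  simp only [graph, mem_iUnion, mem_segment_latticeToR]
  refine exists_congr fun i => exists_congr fun s => exists_congr fun t => ?_
  simp only [neg]
  push_cast
  refine and_congr_right fun _ => and_congr_right fun _ => and_congr_right fun _ =>
    and_congr_right fun _ => ?_
  constructor <;> intro h <;> linarith

lemma latticeXs_graph_neg (P : LatticePath m e) {e' : ℤ} (h : e' = -e) :
    latticeXs (P.neg h).graph = latticeXs P.graph := by
  ext x
  simp only [latticeXs, mem_ofPred_eq, mem_graph_neg]
  constructor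
  · rintro ⟨y, hy⟩
    exact ⟨-y, by simpa using hy⟩
  · rintro ⟨y, hy⟩
    exact ⟨-y, by simpa using hy⟩

lemma IsConvex.neg {P : LatticePath m e} (hP : P.IsConvex) {e' : ℤ} (h : e' = -e) :
    (P.neg h).IsConcave := by
  intro i hi
  have := hP i hi
  simp only [LatticePath.neg]
  linarith

lemma IsConcave.neg {P : LatticePath m e} (hP : P.IsConcave) {e' : ℤ} (h : e' = -e) :
    (P.neg h).IsConvex := by
  intro i hi
  have := hP i hi
  simp only [LatticePath.neg]
  linarith

/-- The path with a single intermediate vertex `(x, y)`. -/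
def through (m : ℕ) (e x y : ℤ) (h0 : 0 < x) (h1 : x < m) : LatticePath m e where
  n := 2
  v := ![(0, 0), (x, y), ((m : ℤ), e)]
  first := rfl
  last := rfl
  mono := by
    intro i
    fin_cases i
    · exact h0
    · exact h1

lemma mem_graph_through {x y : ℤ} (h0 : 0 < x) (h1 : x < m) {z : ℝ × ℝ} :
    z ∈ (through m e x y h0 h1).graph ↔
      z ∈ segment ℝ (latticeToR (0, 0)) (latticeToR (x, y)) ∨
      z ∈ segment ℝ (latticeToR (x, y)) (latticeToR ((m : ℤ), e)) := by
  rw [mem_graph]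
  constructor
  · rintro ⟨k, hk, h⟩
    change k < 2 at hk
    interval_cases k
    · exact Or.inl h
    · exact Or.inr h
  · rintro (h | h)
    · exact ⟨0, Nat.zero_lt_two, h⟩
    · exact ⟨1, Nat.one_lt_two, h⟩

lemma isConcave_through {x y : ℤ} (h0 : 0 < x) (h1 : x < m) (h : x * e ≤ y * m) :
    (through m e x y h0 h1).IsConcave := by
  intro i hi
  obtain rfl : i = 0 := by
    change i + 2 ≤ 2 at hi
    omega
  change (e - y) * (x - 0) ≤ (y - 0) * (m - x)
  linarith

end LatticePath

open LatticePath

variable {θ : ℝ} {m : ℕ}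

lemma floor_mul_neg (θ : ℝ) (m : ℕ) : ⌊(m : ℝ) * -θ⌋ = -⌈(m : ℝ) * θ⌉ := by
  rw [mul_neg, Int.floor_neg]

lemma ceil_mul_eq_neg (θ : ℝ) (m : ℕ) : ⌈(m : ℝ) * θ⌉ = -⌊(m : ℝ) * -θ⌋ := by
  rw [floor_mul_neg, neg_neg]

/-- Reflection turns the minimal path for `θ` into the maximal path for `-θ`. -/
lemma IsMinNegPath.neg {Q : LatticePath m ⌈(m : ℝ) * θ⌉} (hQ : IsMinNegPath θ m Q) :
    IsMaxPosPath (-θ) m (Q.neg (floor_mul_neg θ m)) := by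
  refine ⟨⟨hQ.1.1.neg _, ?_⟩, ?_⟩
  · rintro ⟨x, y⟩ hp
    have := hQ.1.2 _ ((mem_graph_neg _).1 hp)
    simp only at this ⊢
    linarith
  · intro R hR x y y' hy hy'
    have hR' : NegPath θ m (R.neg (ceil_mul_eq_neg θ m)) := by
      refine ⟨hR.1.neg _, ?_⟩
      rintro ⟨x, y⟩ hp
      have := hR.2 _ ((mem_graph_neg _).1 hp)
      simp only at this ⊢
      linarith
    have := hQ.2 _ hR' x (-y') (-y) ((mem_graph_neg _).1 hy')
      ((mem_graph_neg _).2 (by simpa using hy))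
    linarith

/-- A part `a` of the path partition of an admissible path splits `⌊mθ⌋` additively. -/
lemma PosPath.floor_eq_add_of_mem {P : LatticePath m ⌊(m : ℝ) * θ⌋} (hP : PosPath θ m P)
    (hm : 0 < m) {a : ℤ} (ha : 0 < a) (h : a ∈ pathPartition P) :
    a ≤ m ∧ ⌊(m : ℝ) * θ⌋ = ⌊a * θ⌋ + ⌊(m - a) * θ⌋ := by
  obtain ⟨x, ⟨y, hy⟩, ⟨y', hy'⟩, -⟩ := exists_of_mem_setGaps h
  have ha' : (0 : ℝ) < a := by exact_mod_cast ha
  have hx := (P.fst_mem_Icc hy).1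
  have hx' := (P.fst_mem_Icc hy').2
  push_cast at hx hx' hy'
  have ham : (a : ℝ) ≤ m := by linarith
  obtain ⟨ya, hya⟩ := P.exists_mem_graph hm (x := a) ⟨ha'.le, ham⟩
  obtain ⟨yb, hyb⟩ := P.exists_mem_graph hm (x := m - a) ⟨by linarith, by linarith⟩
  have h1 := hP.1.add_le_add (P.zero_mem_graph hm) hya hy hy' ha'.le (by linarith)
    (by linarith) (by ring)
  have h2 := hP.1.add_le_add hy hyb hy' (P.last_mem_graph hm) (by linarith) (by linarith)
    (by linarith) (by ring)
  have h3 := hP.2 _ hya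
  have h4 := hP.2 _ hyb
  simp only at h3 h4
  have h5 : y' - y ≤ ⌊a * θ⌋ := Int.le_floor.2 (by push_cast; linarith)
  have h6 : ⌊(m : ℝ) * θ⌋ - (y' - y) ≤ ⌊(m - a) * θ⌋ :=
    Int.le_floor.2 (by push_cast; linarith)
  have h7 : ⌊a * θ⌋ + ⌊(m - a) * θ⌋ ≤ ⌊(m : ℝ) * θ⌋ := Int.le_floor.2 (by
    push_cast
    linarith [Int.floor_le (a * θ), Int.floor_le ((m - a) * θ)])
  exact ⟨by exact_mod_cast ham, by omega⟩

/-- If the whole length `m` is a part, then the lattice points under the line `y = θx` all lie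
strictly below the chord of the maximal path. -/
lemma IsMaxPosPath.mul_lt_mul_of_mem {P : LatticePath m ⌊(m : ℝ) * θ⌋}
    (hP : IsMaxPosPath θ m P) (hm : 0 < m) (h : (m : ℤ) ∈ pathPartition P) {x y : ℤ}
    (hx0 : 0 < x) (hxm : x < m) (hxy : y ≤ θ * x) : y * m < x * ⌊(m : ℝ) * θ⌋ := by
  by_contra! hle
  have hm' : (0 : ℝ) < m := by exact_mod_cast hm
  have hx0' : (0 : ℝ) < x := by exact_mod_cast hx0
  have hxm' : (x : ℝ) < m := by exact_mod_cast hxm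
  have hle' : (x : ℝ) * ⌊(m : ℝ) * θ⌋ ≤ y * m := by exact_mod_cast hle
  have hgap : ∀ z ∈ latticeXs P.graph, 0 < z → (m : ℤ) ≤ z := by
    obtain ⟨u, ⟨v, hv⟩, ⟨v', hv'⟩, hz⟩ := exists_of_mem_setGaps h
    have h1 := (P.fst_mem_Icc hv).1
    have h2 := (P.fst_mem_Icc hv').2
    push_cast at h1 h2
    obtain rfl : u = 0 := by
      have : (u : ℝ) = 0 := by linarith
      exact_mod_cast this
    simpa using hz
  have hn := P.n_pos hm
  have hv1 := P.latticeToR_vertex_mem_graph hm (k := 1) hn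
  have hfst : ((P.vertex 1).1 : ℝ) = m := by
    have h1 := hgap _ ⟨_, hv1⟩ (by simpa [vertex_zero] using P.vertex_lt hn)
    exact le_antisymm (P.fst_mem_Icc hv1).2 (by exact_mod_cast h1)
  obtain ⟨y', hy'⟩ := P.exists_mem_graph hm (x := x) ⟨hx0'.le, hxm'.le⟩
  have hthrough : PosPath θ m (through m _ x y hx0 hxm) := by
    refine ⟨isConcave_through hx0 hxm hle, ?_⟩
    have hF := Int.floor_le ((m : ℝ) * θ)
    intro p hp
    rcases (mem_graph_through hx0 hxm).1 hp with hp | hp <;>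
    · obtain ⟨s, t, hs, ht, -, h1, h2⟩ := mem_segment_latticeToR.1 hp
      rw [← h1, ← h2]
      push_cast
      nlinarith
  have h1 : (y : ℝ) ≤ y' := hP.2 _ hthrough x y y'
    ((mem_graph_through hx0 hxm).2 (Or.inl (right_mem_segment ..))) hy'
  have hline : ∀ z ∈ P.graph, z.2 * m ≤ (P.vertex 1).2 * z.1 := by
    intro z hz
    have := hP.1.1.graph_le_line hn hz
    simp only [vertex_zero, zero_add, hfst, Int.cast_zero, sub_zero] at this
    rwa [div_mul_eq_mul_div, le_div_iff₀ hm'] at this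
  have hsnd : ((P.vertex 1).2 : ℝ) ≤ ⌊(m : ℝ) * θ⌋ := by
    obtain ⟨c, hc⟩ := hP.1.1.exists_support (P.last_mem_graph hm)
    simpa [latticeToR, hfst] using hc _ hv1
  have h2 := hline _ hy'
  simp only at h2
  have h3 : y' * m ≤ y * m := by nlinarith
  obtain rfl : y' = y := le_antisymm (le_of_mul_le_mul_right h3 hm') h1
  have := hgap x ⟨y, hy'⟩ hx0
  omega

/-- For irrational `θ` and `m > 1`, the partitions `p⁺_θ(m)`
and `p⁻_θ(m)` are disjoint: no positive integer is a part of both. -/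
theorem statement4 (θ : ℝ) (hθ : Irrational θ) (m : ℕ) (hm : 1 < m) :
    ∀ (P : LatticePath m ⌊(m : ℝ) * θ⌋) (Q : LatticePath m ⌈(m : ℝ) * θ⌉),
      IsMaxPosPath θ m P → IsMinNegPath θ m Q →
      ∀ a : ℤ, 0 < a → ¬(a ∈ pathPartition P ∧ a ∈ pathPartition Q) := by
  rintro P Q hP hQ a ha ⟨haP, haQ⟩
  have hm0 : 0 < m := by omega
  have haQ' : a ∈ pathPartition (Q.neg (floor_mul_neg θ m)) := by
    rwa [pathPartition, latticeXs_graph_neg]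
  have hfloor : ∀ k : ℤ, k ≠ 0 → ⌊(k : ℝ) * -θ⌋ = -⌊(k : ℝ) * θ⌋ - 1 := by
    intro k hk
    rw [Int.floor_eq_iff]
    have h1 := Int.floor_le ((k : ℝ) * θ)
    have h2 := Int.lt_floor_add_one ((k : ℝ) * θ)
    have h3 : (⌊(k : ℝ) * θ⌋ : ℝ) ≠ k * θ := (hθ.intCast_mul hk).ne_int _ |>.symm
    have h4 := lt_of_le_of_ne h1 h3
    push_cast
    constructor <;> linarith
  obtain ⟨ham, h1⟩ := hP.1.floor_eq_add_of_mem hm0 ha haP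
  obtain ⟨-, h2⟩ := hQ.neg.1.floor_eq_add_of_mem hm0 ha haQ'
  have hfm := hfloor m (by omega)
  push_cast at hfm
  rcases ham.lt_or_eq with hlt | rfl
  · have h3 := hfloor (m - a) (by omega)
    have h4 := hfloor a (by omega)
    push_cast at h3
    omega
  · have hPlt := fun x y => hP.mul_lt_mul_of_mem hm0 haP (x := x) (y := y)
    have hQlt := fun x y => hQ.neg.mul_lt_mul_of_mem hm0 haQ' (x := x) (y := y)
    rw [hfm] at hQlt
    have hF := Int.floor_le ((m : ℝ) * θ)
    set F := ⌊(m : ℝ) * θ⌋ with hFdef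
    have hcop : IsCoprime F (m : ℤ) := by
      rw [Int.isCoprime_iff_gcd_eq_one]
      by_contra hd
      obtain ⟨y, hy⟩ := Int.gcd_dvd_left F (m : ℤ)
      obtain ⟨x, hx⟩ := Int.gcd_dvd_right F (m : ℤ)
      have hd0 : 0 < F.gcd m := Int.gcd_pos_of_ne_zero_right _ (by omega)
      generalize F.gcd m = d at *
      have hd1 : (1 : ℤ) < d := by omega
      have hx0 : 0 < x := by
        have : 0 < (d : ℤ) * x := by omega
        exact pos_of_mul_pos_right this (by omega)
      refine absurd (hPlt x y hx0 (by nlinarith) ?_) (by rw [hx, hy]; linarith)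
      have hdr : (0 : ℝ) < d := by exact_mod_cast hd0
      have hxr : (m : ℝ) = d * x := by exact_mod_cast hx
      have hyr : (F : ℝ) = d * y := by exact_mod_cast hy
      rw [hxr, hyr] at hF
      refine le_of_mul_le_mul_left ?_ hdr
      linarith
    obtain ⟨u, v, huv⟩ := hcop
    have hdiv := Int.emod_add_mul_ediv (-u) m
    have hnn := Int.emod_nonneg (-u) (show (m : ℤ) ≠ 0 by omega)
    have hxm := Int.emod_lt_of_pos (-u) (show (0 : ℤ) < m by omega)
    generalize (-u) % (m : ℤ) = x at *
    generalize (-u) / (m : ℤ) = w at *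
    have hxF : (v - w * F) * m = x * F + 1 := by
      obtain rfl : x = -u - m * w := by linarith
      linarith
    have hx0 : 0 < x := by
      rcases hnn.lt_or_eq with h | rfl
      · exact h
      · have : (m : ℤ) ∣ 1 := ⟨v - w * F, by linarith⟩
        have := Int.le_of_dvd one_pos this
        omega
    rcases le_total ((v - w * F : ℤ) : ℝ) (θ * x) with hle | hle
    · have := hPlt x _ hx0 hxm hle
      omega
    · have := hQlt x (-(v - w * F)) hx0 hxm (by push_cast at hle ⊢; linarith)
      nlinarith
end
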